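/- arXiv:1701.04260 — 5 statements merged into one kernel-verified Lean document; each statement's English description precedes it below -/
import Mathlib

section
/- Let H ∈ (0,1/2) and 0 < T ≤ t < s with s ≥ 2t. Then ∫_0^T ((t−u)·(s−u))^{H−1/2} du = ((s−t)^{H−1/2}/(H+1/2)) · ( t^{H+1/2}·F(−t/(s−t)) − (t−T)^{H+1/2}·F((T−t)/(s−t)) ), where F(z) := ₂F₁(1/2−H, H+1/2; 3/2+H; z). -/
open scoped Real

/-- The Gauss hypergeometric function `₂F₁(a,b;c;z)`, defined by its power series
`∑ (a)_n (b)_n / (c)_n · zⁿ/n!` with `(x)_n` the rising factorial (Pochhammer symbol). -/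
noncomputable def hyp2F1 (a b c z : ℝ) : ℝ :=
  ∑' n : ℕ, ((ascPochhammer ℝ n).eval a * (ascPochhammer ℝ n).eval b /
    (ascPochhammer ℝ n).eval c) * z ^ n / (n.factorial : ℝ)

lemma ascPochhammer_eval_add_one_div {b : ℝ} (hb : 0 < b) (n : ℕ) :
    (ascPochhammer ℝ n).eval b / (ascPochhammer ℝ n).eval (b + 1) = b / (b + n) := by
  have h : b * (ascPochhammer ℝ n).eval (b + 1) = (ascPochhammer ℝ n).eval b * (b + n) := by
    rw [← ascPochhammer_succ_eval, ascPochhammer_succ_left]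
    simp
  have hpos := ascPochhammer_pos n (b + 1) (by positivity)
  rw [div_eq_div_iff hpos.ne' (by positivity), h]

lemma summable_ascPochhammer_div_factorial_div_add {a b : ℝ} (ha : 0 < a) (ha1 : a < 1)
    (hb : 0 < b) :
    Summable fun n : ℕ => (ascPochhammer ℝ n).eval a / n.factorial / (b + n) := by
  set p : ℕ → ℝ := fun n => (ascPochhammer ℝ n).eval a / n.factorial with hp
  have hp_nonneg (n : ℕ) : 0 ≤ p n := div_nonneg (ascPochhammer_pos n a ha).le (by positivity)
  have hp_diff (n : ℕ) : (1 - a) * (p n / (n + 1)) = p n - p (n + 1) := by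
    simp only [hp, ascPochhammer_succ_eval, Nat.factorial_succ, Nat.cast_mul, Nat.cast_succ]
    field_simp
    ring
  have hp_telescope : Summable fun n => (1 - a) * (p n / (n + 1)) := by
    refine summable_of_sum_range_le (c := 1)
      (fun n => mul_nonneg (by linarith) (div_nonneg (hp_nonneg n) (by positivity))) fun N => ?_
    simp only [hp_diff, Finset.sum_range_sub']
    have : p 0 = 1 := by simp [hp]
    linarith [hp_nonneg N]
  have hp_summable := (summable_mul_left_iff (by linarith)).1 hp_telescope
  refine (hp_summable.mul_left (1 + 1 / b)).of_nonneg_of_le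
    (fun n => div_nonneg (hp_nonneg n) (by positivity)) fun n => ?_
  rw [mul_div_left_comm]
  refine (div_eq_mul_one_div (p n) _).trans_le
    (mul_le_mul_of_nonneg_left ?_ (hp_nonneg n))
  rw [div_le_div_iff₀ (by positivity) (by positivity)]
  have : 0 ≤ (n : ℝ) / b := by positivity
  have : (1 + 1 / b) * (b + n) = b + n + 1 + n / b := by field_simp; ring
  linarith

lemma hasSum_one_sub_rpow_neg (a : ℝ) {y : ℝ} (hy : |y| < 1) :
    HasSum (fun n : ℕ => (ascPochhammer ℝ n).eval a / n.factorial * y ^ n)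
      ((1 - y) ^ (-a)) := by
  have h := (Real.one_div_one_sub_rpow_hasFPowerSeriesOnBall_zero a).hasSum (y := y)
    (by simpa [enorm_eq_nnnorm, ← NNReal.coe_lt_coe] using hy)
  have hcoeff (n : ℕ) : (ascPochhammer ℝ n).eval a / n.factorial = Ring.choose (a + n - 1) n := by
    rw [← Ring.multichoose_eq, div_eq_iff (by positivity), mul_comm, ← nsmul_eq_mul,
      Ring.factorial_nsmul_multichoose_eq_ascPochhammer, Polynomial.ascPochhammer_smeval_eq_eval]
  have hy1 : 0 ≤ 1 - y := by linarith [(abs_lt.1 hy).2]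
  simpa [FormalMultilinearSeries.ofScalars_apply_eq, hcoeff, mul_comm, Real.rpow_neg hy1] using h

open MeasureTheory in
/-- Euler's integral for `₂F₁(a, b; b + 1; ·)`, up to the boundary of the disc of convergence. -/
theorem integral_rpow_mul_add_rpow_neg {a b d x : ℝ} (ha : 0 < a) (ha1 : a < 1) (hb : 0 < b)
    (hd : 0 < d) (hx : 0 ≤ x) (hxd : x ≤ d) :
    ∫ v in (0 : ℝ)..x, v ^ (b - 1) * (v + d) ^ (-a) =
      d ^ (-a) / b * (x ^ b * hyp2F1 a b (b + 1) (-x / d)) := by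
  set p : ℕ → ℝ := fun n => (ascPochhammer ℝ n).eval a / n.factorial with hp
  have hp_nonneg (n : ℕ) : 0 ≤ p n := div_nonneg (ascPochhammer_pos n a ha).le (by positivity)
  have hexp (n : ℕ) : -1 < b + n - 1 := by
    have : (0 : ℝ) ≤ n := n.cast_nonneg
    linarith
  have hintegral (n : ℕ) :
      ∫ v in Set.Ioo 0 x, v ^ (b + n - 1) = x ^ (b + n) / (b + n) := by
    rw [← integral_Ioc_eq_integral_Ioo, ← intervalIntegral.integral_of_le hx,
      integral_rpow (Or.inl (hexp n)), sub_add_cancel, Real.zero_rpow (by positivity), sub_zero]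
  set F : ℕ → ℝ → ℝ := fun n v => d ^ (-a) * p n * (-1 / d) ^ n * v ^ (b + n - 1) with hF
  have hF_int (n : ℕ) : Integrable (F n) (volume.restrict (Set.Ioo 0 x)) := by
    have h := intervalIntegral.intervalIntegrable_rpow' (a := 0) (b := x) (hexp n)
    rw [intervalIntegrable_iff_integrableOn_Ioo_of_le hx] at h
    exact h.const_mul _
  have hF_sum : Summable fun n => ∫ v in Set.Ioo 0 x, ‖F n v‖ := by
    have hnorm (n : ℕ) : ∫ v in Set.Ioo 0 x, ‖F n v‖ =
        d ^ (-a) * x ^ b * (p n / (b + n)) * (x / d) ^ n := by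
      calc ∫ v in Set.Ioo 0 x, ‖F n v‖
          = ∫ v in Set.Ioo 0 x, d ^ (-a) * p n * (1 / d) ^ n * v ^ (b + n - 1) := by
            refine setIntegral_congr_fun measurableSet_Ioo fun v hv => ?_
            simp only [hF, norm_mul, norm_pow, norm_div, norm_neg, norm_one, Real.norm_eq_abs]
            rw [abs_of_nonneg (Real.rpow_nonneg hd.le _), abs_of_nonneg (hp_nonneg n),
              abs_of_pos hd, abs_of_nonneg (Real.rpow_nonneg hv.1.le _)]
        _ = _ := by
            rw [integral_const_mul, hintegral, Real.rpow_add_natCast' hx (by positivity),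
              div_pow, div_pow]
            ring
    simp only [hnorm]
    refine ((summable_ascPochhammer_div_factorial_div_add ha ha1 hb).mul_left
      (d ^ (-a) * x ^ b)).of_nonneg_of_le (fun n => ?_) fun n => ?_
    · have := hp_nonneg n
      positivity
    · refine mul_le_of_le_one_right ?_ (pow_le_one₀ (by positivity) ((div_le_one hd).2 hxd))
      have := hp_nonneg n
      positivity
  have hF_tsum {v : ℝ} (hv : v ∈ Set.Ioo 0 x) :
      v ^ (b - 1) * (v + d) ^ (-a) = ∑' n, F n v := by
    have hvd : |-v / d| < 1 := by
      rw [abs_div, abs_neg, abs_of_pos hv.1, abs_of_pos hd, div_lt_one hd]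
      exact hv.2.trans_le hxd
    have h := ((hasSum_one_sub_rpow_neg a hvd).mul_left (v ^ (b - 1) * d ^ (-a))).tsum_eq
    have hfactor : v + d = d * (1 - -v / d) := by field_simp; ring
    rw [hfactor, Real.mul_rpow hd.le (by linarith [(abs_lt.1 hvd).2]), ← mul_assoc, ← h]
    refine tsum_congr fun n => ?_
    simp only [hF, hp]
    rw [show b + n - 1 = b - 1 + n by ring, Real.rpow_add_natCast hv.1.ne',
      show -v / d = -1 / d * v by ring, mul_pow]
    ring
  rw [intervalIntegral.integral_of_le hx, integral_Ioc_eq_integral_Ioo,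
    setIntegral_congr_fun measurableSet_Ioo fun v hv => hF_tsum hv,
    ← integral_tsum_of_summable_integral_norm hF_int hF_sum, hyp2F1, ← tsum_mul_left,
    ← tsum_mul_left]
  refine tsum_congr fun n => ?_
  rw [mul_div_assoc (Polynomial.eval a _), ascPochhammer_eval_add_one_div hb, integral_const_mul,
    hintegral, Real.rpow_add_natCast' hx (by positivity), show -x / d = -1 / d * x by ring, mul_pow]
  simp only [hp]
  field_simp

lemma intervalIntegrable_rpow_mul_add_rpow_neg {a b d x : ℝ} (hb : 0 < b) (hd : 0 < d)
    (hx : 0 ≤ x) :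
    IntervalIntegrable (fun v => v ^ (b - 1) * (v + d) ^ (-a)) MeasureTheory.volume 0 x := by
  refine (intervalIntegral.intervalIntegrable_rpow' (by linarith)).mul_continuousOn ?_
  refine ContinuousOn.rpow_const (by fun_prop) fun v hv => Or.inl ?_
  rw [Set.uIcc_of_le hx] at hv
  linarith [hv.1]

/-- The covariance integral `∫₀ᵀ ((t-u)(s-u))^{H-1/2} du` of the rough Bergomi Volterra
process, expressed via the hypergeometric function `F(z) = ₂F₁(1/2-H, H+1/2; 3/2+H; z)`. -/
theorem stmt1 (H T t s : ℝ) (hH : H ∈ Set.Ioo (0:ℝ) (1/2))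
    (hT : 0 < T) (hTt : T ≤ t) (hts : t < s) (hs : 2 * t ≤ s) :
    ∫ u in (0:ℝ)..T, ((t - u) * (s - u)) ^ (H - 1/2) =
      ((s - t) ^ (H - 1/2) / (H + 1/2)) *
        (t ^ (H + 1/2) * hyp2F1 (1/2 - H) (H + 1/2) (3/2 + H) (-t / (s - t)) -
         (t - T) ^ (H + 1/2) * hyp2F1 (1/2 - H) (H + 1/2) (3/2 + H) ((T - t) / (s - t))) := by
  obtain ⟨hH0, hH1⟩ := hH
  have hd : 0 < s - t := by linarith
  have hint {x : ℝ} (hx : 0 ≤ x) := intervalIntegrable_rpow_mul_add_rpow_neg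
    (a := 1/2 - H) (b := H + 1/2) (by linarith) hd hx
  have hcov {x : ℝ} (hx : 0 ≤ x) (hxd : x ≤ s - t) := integral_rpow_mul_add_rpow_neg
    (a := 1/2 - H) (b := H + 1/2) (by linarith) (by linarith) (by linarith) hd hx hxd
  have hsubst : ∫ u in (0:ℝ)..T, ((t - u) * (s - u)) ^ (H - 1/2) =
      ∫ v in (t - T)..t, v ^ (H + 1/2 - 1) * (v + (s - t)) ^ (-(1/2 - H)) := by
    have h := intervalIntegral.integral_comp_sub_left (a := 0) (b := T)
      (fun v => v ^ (H + 1/2 - 1) * (v + (s - t)) ^ (-(1/2 - H))) t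
    rw [sub_zero] at h
    rw [← h]
    refine intervalIntegral.integral_congr fun u hu => ?_
    rw [Set.uIcc_of_le hT.le] at hu
    rw [Real.mul_rpow (by linarith [hu.2]) (by linarith [hu.2])]
    ring_nf
  rw [hsubst, ← intervalIntegral.integral_interval_sub_left (hint (by linarith))
    (hint (sub_nonneg.2 hTt)), hcov (by linarith) (by linarith),
    hcov (sub_nonneg.2 hTt) (by linarith), ← mul_sub, neg_sub, neg_sub,
    show H + 1/2 + 1 = 3/2 + H by ring]
end

section
/- In the VIX framework below, the expected VIX future satisfies the lower bound E[VIX_T] ≥ Δ^{−1} ∫_T^{T+Δ} sqrt(ξ0(t)) · exp( (ν²C_H²/(4H)) · ((t−T)^{2H} − t^{2H}) ) dt. -/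
open MeasureTheory ProbabilityTheory

/-- The constant `C_H` of the rough Bergomi model. -/
noncomputable def C_H (H : ℝ) : ℝ :=
  Real.sqrt (2 * H * Real.Gamma (3/2 - H) / (Real.Gamma (H + 1/2) * Real.Gamma (2 - 2*H)))

/-- The square root of an integrable function on a finite measure space is integrable. -/
lemma MeasureTheory.Integrable.sqrt {α : Type*} [MeasurableSpace α] {μ : Measure α}
    [IsFiniteMeasure μ] {f : α → ℝ} (hf : Integrable f μ) :
    Integrable (fun x => √(f x)) μ := by
  refine (hf.norm.add (integrable_const (1 : ℝ))).mono'
    (Real.continuous_sqrt.comp_aestronglyMeasurable hf.1) (ae_of_all _ fun x => ?_)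
  simp only [Pi.add_apply, Real.norm_eq_abs, abs_of_nonneg (Real.sqrt_nonneg _)]
  refine (Real.sqrt_le_sqrt (le_abs_self (f x))).trans ?_
  nlinarith [Real.sq_sqrt (abs_nonneg (f x)), sq_nonneg (√|f x| - 1), Real.sqrt_nonneg |f x|]

/-- The integral of the square root of a nonnegative function over a probability space is at most
the square root of its integral. -/
lemma integral_sqrt_le_sqrt_integral {α : Type*} [MeasurableSpace α] {μ : Measure α}
    [IsProbabilityMeasure μ] {f : α → ℝ} (hf : Integrable f μ) (hf0 : 0 ≤ᵐ[μ] f) :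
    ∫ x, √(f x) ∂μ ≤ √(∫ x, f x ∂μ) :=
  Real.strictConcaveOn_sqrt.concaveOn.le_map_integral Real.continuous_sqrt.continuousOn
    isClosed_Ici hf0 hf hf.sqrt

/-- Integrating out one variable under the square root increases the expected square root. -/
lemma integral_integral_sqrt_le {α Ω : Type*} [MeasurableSpace α] [MeasurableSpace Ω]
    {μ : Measure α} {P : Measure Ω} [IsProbabilityMeasure μ] [IsProbabilityMeasure P]
    {f : α → Ω → ℝ} (hf : Integrable (Function.uncurry f) (μ.prod P))
    (hf0 : ∀ᵐ x ∂μ, ∀ ω, 0 ≤ f x ω) :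
    ∫ x, ∫ ω, √(f x ω) ∂P ∂μ ≤ ∫ ω, √(∫ x, f x ω ∂μ) ∂P := by
  have hs : Integrable (Function.uncurry fun x ω => √(f x ω)) (μ.prod P) := hf.sqrt
  rw [integral_integral_swap hs]
  refine integral_mono_ae hs.integral_prod_right hf.integral_prod_right.sqrt ?_
  filter_upwards [hf.prod_left_ae] with ω hω
  exact integral_sqrt_le_sqrt_integral hω (hf0.mono fun x hx => hx ω)

/-- Integration over an interval, normalised by its length, is integration against the uniform
probability measure on it. -/
lemma inv_mul_intervalIntegral_eq_integral_cond (f : ℝ → ℝ) (a : ℝ) {d : ℝ} (hd : 0 < d) :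
    d⁻¹ * ∫ t in a..(a + d), f t = ∫ t, f t ∂(volume[|Set.Icc a (a + d)]) := by
  rw [ProbabilityTheory.cond, integral_smul_measure, intervalIntegral.integral_of_le (by linarith),
    integral_Icc_eq_integral_Ioc]
  simp [hd.le]

/-- Lower bound for the VIX future price in the rough Bergomi model:
`E[VIX_T] ≥ Δ⁻¹ ∫_T^{T+Δ} sqrt(ξ0(t)) exp((ν²C_H²/(4H))((t-T)^{2H} - t^{2H})) dt`. -/
theorem stmt4 {Ω : Type*} [MeasurableSpace Ω] (P : Measure Ω) [IsProbabilityMeasure P]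
    (H ν T Δ : ℝ) (hH : H ∈ Set.Ioo (0:ℝ) (1/2)) (hν : 0 < ν) (hT : 0 ≤ T) (hΔ : 0 < Δ)
    (ξ0 : ℝ → ℝ) (hξ0cont : ContinuousOn ξ0 (Set.Icc T (T + Δ)))
    (hξ0pos : ∀ t ∈ Set.Icc T (T + Δ), 0 < ξ0 t)
    (G : Ω → ℝ → ℝ) (hGmeas : Measurable (Function.uncurry G))
    (hGlaw : ∀ t ∈ Set.Icc T (T + Δ), Measure.map (fun ω => G ω t) P =
      gaussianReal 0 (((t ^ (2*H) - (t - T) ^ (2*H)) / (2*H)).toNNReal))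
    (hVIXint : Integrable (fun ω => Real.sqrt (Δ⁻¹ * ∫ t in T..(T + Δ),
        ξ0 t * Real.exp (2 * ν * C_H H * G ω t) *
          Real.exp ((ν^2 * (C_H H)^2 / H) * ((t - T)^(2*H) - t^(2*H))))) P) :
    Δ⁻¹ * (∫ t in T..(T + Δ), Real.sqrt (ξ0 t) *
        Real.exp ((ν^2 * (C_H H)^2 / (4*H)) * ((t - T)^(2*H) - t^(2*H))))
      ≤ ∫ ω, Real.sqrt (Δ⁻¹ * ∫ t in T..(T + Δ),
          ξ0 t * Real.exp (2 * ν * C_H H * G ω t) *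
            Real.exp ((ν^2 * (C_H H)^2 / H) * ((t - T)^(2*H) - t^(2*H)))) ∂P := by
  obtain ⟨hH0, -⟩ := hH
  set μ : Measure ℝ := volume[|Set.Icc T (T + Δ)] with hμ
  have : IsProbabilityMeasure μ := by
    refine cond_isProbabilityMeasure_of_finite ?_ ?_ <;> simp [hΔ]
  have hmem : ∀ᵐ t ∂μ, t ∈ Set.Icc T (T + Δ) := ae_cond_mem measurableSet_Icc
  have hξint : Integrable ξ0 μ :=
    hξ0cont.integrableOn_Icc.smul_measure (by simp [hΔ])
  have hexp : ∀ t ∈ Set.Icc T (T + Δ), ∀ s : ℝ,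
      Integrable (fun ω => Real.exp (s * G ω t)) P ∧
        ∫ ω, Real.exp (s * G ω t) ∂P =
          Real.exp (s ^ 2 / (4 * H) * (t ^ (2 * H) - (t - T) ^ (2 * H))) := by
    intro t ht s
    have hGt : AEMeasurable (fun ω => G ω t) P :=
      (hGmeas.comp measurable_prodMk_right).aemeasurable
    have hv : 0 ≤ (t ^ (2*H) - (t - T) ^ (2*H)) / (2*H) :=
      div_nonneg (sub_nonneg.2 (Real.rpow_le_rpow (by linarith [ht.1]) (by linarith)
        (by linarith))) (by linarith)
    constructor
    · have h := integrable_exp_mul_gaussianReal (μ := 0)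
        (v := ((t ^ (2*H) - (t - T) ^ (2*H)) / (2*H)).toNNReal) s
      rw [← hGlaw t ht] at h
      exact h.comp_aemeasurable hGt
    · have h := mgf_gaussianReal (hGlaw t ht) s
      rw [mgf] at h
      rw [h, Real.coe_toNNReal _ hv]
      congr 1
      field_simp
      ring
  set f : ℝ → Ω → ℝ := fun t ω => ξ0 t * Real.exp (2 * ν * C_H H * G ω t) *
    Real.exp ((ν^2 * (C_H H)^2 / H) * ((t - T)^(2*H) - t^(2*H))) with hf
  have hf0 : ∀ t ∈ Set.Icc T (T + Δ), ∀ ω, 0 ≤ f t ω := fun t ht ω => by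
    have := hξ0pos t ht
    positivity
  have hf_mean : ∀ t ∈ Set.Icc T (T + Δ), ∫ ω, f t ω ∂P = ξ0 t := fun t ht => by
    simp only [hf]
    rw [integral_mul_const, integral_const_mul, (hexp t ht _).2, mul_assoc, ← Real.exp_add]
    convert mul_one (ξ0 t)
    rw [Real.exp_eq_one_iff]
    field_simp
    ring
  have hf_sqrt : ∀ t ∈ Set.Icc T (T + Δ), ∫ ω, √(f t ω) ∂P = √(ξ0 t) *
      Real.exp ((ν^2 * (C_H H)^2 / (4*H)) * ((t - T)^(2*H) - t^(2*H))) := fun t ht => by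
    have hsq : ∀ ω, √(f t ω) = √(ξ0 t) * Real.exp (ν * C_H H * G ω t) *
        Real.exp ((ν^2 * (C_H H)^2 / (2*H)) * ((t - T)^(2*H) - t^(2*H))) := fun ω => by
      have := hξ0pos t ht
      simp only [hf]
      rw [Real.sqrt_mul (by positivity), Real.sqrt_mul this.le, ← Real.exp_half, ← Real.exp_half]
      congr 3 <;> ring
    simp only [hsq]
    rw [integral_mul_const, integral_const_mul, (hexp t ht _).2, mul_assoc, ← Real.exp_add]
    congr 2
    field_simp
    ring
  have hf_int : Integrable (Function.uncurry f) (μ.prod P) := by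
    have hGswap : Measurable fun p : ℝ × Ω => G p.2 p.1 := hGmeas.comp measurable_swap
    have hmeas : AEStronglyMeasurable (Function.uncurry f) (μ.prod P) :=
      (hξint.1.comp_fst.mul (Measurable.aestronglyMeasurable (by fun_prop))).mul
        (Measurable.aestronglyMeasurable (by fun_prop))
    rw [integrable_prod_iff hmeas]
    refine ⟨hmem.mono fun t ht =>
        ((hexp t ht (2 * ν * C_H H)).1.const_mul (ξ0 t)).mul_const
          (Real.exp ((ν^2 * (C_H H)^2 / H) * ((t - T)^(2*H) - t^(2*H)))),
      hξint.congr (hmem.mono fun t ht => ?_)⟩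
    simp only [Function.uncurry, Real.norm_eq_abs, abs_of_nonneg (hf0 t ht _), hf_mean t ht]
  simp only [inv_mul_intervalIntegral_eq_integral_cond _ T hΔ]
  rw [← hμ, ← integral_congr_ae (hmem.mono hf_sqrt)]
  exact integral_integral_sqrt_le hf_int (hmem.mono hf0)
end

section
/- Let H ∈ (0,1/2), T > 0 and ε > 0. For t > T define ρ_ε(t) := ( ∫_0^T (t−u)^{H−1/2}·(t+ε−u)^{H−1/2} du ) / sqrt( ( ∫_0^T (t−u)^{2H−1} du ) · ( ∫_0^T (t+ε−u)^{2H−1} du ) ). Then for all T < t₁ < t₂, the strict inequality ρ_ε(t₁) < ρ_ε(t₂) holds. -/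
open Set intervalIntegral in
/-- If `f` and `g` are positive, continuous and strictly increasing on `[a, b]` with the same
integral, and `g / f` is strictly decreasing, then `g` has the smaller second moment. -/
theorem integral_sq_lt_integral_sq_of_strictAntiOn_div {a b : ℝ} (hab : a < b) {f g : ℝ → ℝ}
    (hfc : ContinuousOn f (Icc a b)) (hgc : ContinuousOn g (Icc a b))
    (hf : StrictMonoOn f (Icc a b)) (hg : StrictMonoOn g (Icc a b))
    (hf0 : ∀ v ∈ Icc a b, 0 < f v) (hgf : StrictAntiOn (fun v => g v / f v) (Icc a b))
    (hint : ∫ v in a..b, g v = ∫ v in a..b, f v) :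
    ∫ v in a..b, g v ^ 2 < ∫ v in a..b, f v ^ 2 := by
  have hI {h : ℝ → ℝ} (hh : ContinuousOn h (Icc a b)) :
      IntervalIntegrable h MeasureTheory.volume a b :=
    hh.intervalIntegrable_of_Icc hab.le
  obtain ⟨c, hc, hcfg⟩ : ∃ c ∈ Ioo a b, g c = f c := by
    by_contra! hne
    have hne' : ∀ v ∈ Ioo a b, g v - f v ≠ 0 := fun v hv => sub_ne_zero.2 (hne v hv)
    have hd : ContinuousOn (fun v => g v - f v) (Ioo a b) :=
      (hgc.sub hfc).mono Ioo_subset_Icc_self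
    have hzero : ∫ v in a..b, (g v - f v) = 0 := by
      rw [integral_sub (hI hgc) (hI hfc), hint, sub_self]
    have hmid : (a + b) / 2 ∈ Ioo a b := ⟨by linarith, by linarith⟩
    have hsign : ∀ u ∈ Ioo a b, ∀ v ∈ Ioo a b, g u - f u < 0 → 0 < g v - f v → False := by
      intro u hu v hv h1 h2
      obtain ⟨w, hw, hw0⟩ := isPreconnected_Ioo.intermediate_value hu hv hd
        (show (0 : ℝ) ∈ Icc (g u - f u) (g v - f v) from ⟨h1.le, h2.le⟩)
      exact hne' w hw hw0
    rcases lt_or_gt_of_ne (hne' _ hmid) with h | h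
    · have hpos : 0 < ∫ v in a..b, -(g v - f v) :=
        intervalIntegral_pos_of_pos_on (hI (hgc.sub hfc).neg) (fun v hv => by
          rcases lt_or_gt_of_ne (hne' v hv) with h' | h'
          · linarith
          · exact (hsign _ hmid v hv h h').elim) hab
      rw [integral_neg, hzero] at hpos
      simp at hpos
    · have hpos : 0 < ∫ v in a..b, (g v - f v) :=
        intervalIntegral_pos_of_pos_on (hI (hgc.sub hfc)) (fun v hv => by
          rcases lt_or_gt_of_ne (hne' v hv) with h' | h'
          · exact (hsign v hv _ hmid h' h).elim
          · exact h') hab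
      exact absurd hzero hpos.ne'
  have hcI : c ∈ Icc a b := Ioo_subset_Icc_self hc
  have hqc : g c / f c = 1 := by rw [hcfg, div_self (hf0 c hcI).ne']
  have hpos : ∀ v ∈ Icc a b, v ≠ c → 0 < (f v - g v) * (f v + g v - 2 * f c) := by
    intro v hv hvc
    rcases lt_or_gt_of_ne hvc with h | h
    · have h1 : 1 < g v / f v := hqc ▸ hgf hv hcI h
      rw [one_lt_div (hf0 v hv)] at h1
      have h2 := hf hv hcI h
      have h3 := hg hv hcI h
      exact mul_pos_of_neg_of_neg (by linarith) (by linarith)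
    · have h1 : g v / f v < 1 := hqc ▸ hgf hcI hv h
      rw [div_lt_one (hf0 v hv)] at h1
      have h2 := hf hcI hv h
      have h3 := hg hcI hv h
      exact mul_pos (by linarith) (by linarith)
  have hcont : ContinuousOn (fun v => (f v - g v) * (f v + g v - 2 * f c)) (Icc a b) := by
    fun_prop
  have hmain : ∫ v in a..b, (0 : ℝ) < ∫ v in a..b, (f v - g v) * (f v + g v - 2 * f c) :=
    integral_lt_integral_of_continuousOn_of_le_of_exists_lt hab continuousOn_const hcont
      (fun v hv => by
        by_cases h : v = c
        · simp [h, hcfg]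
        · exact (hpos v (Ioc_subset_Icc_self hv) h).le)
      ⟨a, left_mem_Icc.2 hab.le, hpos a (left_mem_Icc.2 hab.le) hc.1.ne⟩
  have hexp : ∫ v in a..b, (f v - g v) * (f v + g v - 2 * f c)
      = (∫ v in a..b, f v ^ 2) - (∫ v in a..b, g v ^ 2)
        - 2 * f c * ((∫ v in a..b, f v) - ∫ v in a..b, g v) := by
    rw [← integral_sub (hI hfc) (hI hgc), ← integral_const_mul,
      ← integral_sub (hI (hfc.fun_pow 2)) (hI (hgc.fun_pow 2)),
      ← integral_sub (hI ((hfc.fun_pow 2).fun_sub (hgc.fun_pow 2)))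
        (hI (continuousOn_const.fun_mul (hfc.fun_sub hgc)))]
    refine integral_congr fun v _ => ?_
    ring
  rw [hexp, hint, sub_self, mul_zero, sub_zero, integral_zero] at hmain
  linarith

open Set intervalIntegral in
/-- If `f` and `g` are positive, continuous and strictly increasing on `[a, b]` and `g / f` is
strictly decreasing, then `g` has the larger ratio of mean to root mean square. -/
theorem integral_div_sqrt_lt_of_strictAntiOn_div {a b : ℝ} (hab : a < b) {f g : ℝ → ℝ}
    (hfc : ContinuousOn f (Icc a b)) (hgc : ContinuousOn g (Icc a b))
    (hf : StrictMonoOn f (Icc a b)) (hg : StrictMonoOn g (Icc a b))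
    (hf0 : ∀ v ∈ Icc a b, 0 < f v) (hg0 : ∀ v ∈ Icc a b, 0 < g v)
    (hgf : StrictAntiOn (fun v => g v / f v) (Icc a b)) :
    (∫ v in a..b, f v) / √(∫ v in a..b, f v ^ 2)
      < (∫ v in a..b, g v) / √(∫ v in a..b, g v ^ 2) := by
  have hpos {h : ℝ → ℝ} (hc : ContinuousOn h (Icc a b)) (h0 : ∀ v ∈ Icc a b, 0 < h v) :
      0 < ∫ v in a..b, h v :=
    intervalIntegral_pos_of_pos_on (hc.intervalIntegrable_of_Icc hab.le)
      (fun v hv => h0 v (Ioo_subset_Icc_self hv)) hab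
  have hF := hpos hfc hf0
  have hG := hpos hgc hg0
  have hF2 := hpos (hfc.fun_pow 2) fun v hv => pow_pos (hf0 v hv) 2
  have hG2 := hpos (hgc.fun_pow 2) fun v hv => pow_pos (hg0 v hv) 2
  set F := ∫ v in a..b, f v
  set G := ∫ v in a..b, g v
  have hr : 0 < F / G := div_pos hF hG
  have key := integral_sq_lt_integral_sq_of_strictAntiOn_div hab (g := fun v => F / G * g v) hfc
    (continuousOn_const.mul hgc) hf (fun u hu v hv huv => by
      have := hg hu hv huv
      simp only
      gcongr) hf0
    (fun u hu v hv huv => by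
      have := mul_lt_mul_of_pos_left (hgf hu hv huv) hr
      simpa only [mul_div_assoc] using this)
    (by rw [integral_const_mul]; exact div_mul_cancel₀ F hG.ne')
  simp only [mul_pow, integral_const_mul] at key
  rw [div_lt_div_iff₀ (Real.sqrt_pos.2 hF2) (Real.sqrt_pos.2 hG2)]
  have key' : F ^ 2 * (∫ v in a..b, g v ^ 2) < G ^ 2 * ∫ v in a..b, f v ^ 2 := by
    rw [div_pow, div_mul_eq_mul_div, div_lt_iff₀ (by positivity)] at key
    linarith
  have := Real.sqrt_lt_sqrt (by positivity) key'
  rwa [Real.sqrt_mul (sq_nonneg F), Real.sqrt_mul (sq_nonneg G), Real.sqrt_sq hF.le,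
    Real.sqrt_sq hG.le] at this

/-- The quantile function of the probability density proportional to `x ^ (p - 1)` on
`[a, b]`. -/
noncomputable def powQuantile (p a b v : ℝ) : ℝ := (a ^ p + v * (b ^ p - a ^ p)) ^ (1 / p)

section powQuantile

open Set

variable {p a b v : ℝ}

theorem powQuantile_base_pos (hp : 0 < p) (ha : 0 < a) (hab : a < b) (hv : 0 ≤ v) :
    0 < a ^ p + v * (b ^ p - a ^ p) := by
  have h1 := Real.rpow_pos_of_pos ha p
  have h2 := Real.rpow_lt_rpow ha.le hab hp
  have h3 := mul_nonneg hv (sub_pos.2 h2).le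
  linarith

theorem powQuantile_pos (hp : 0 < p) (ha : 0 < a) (hab : a < b) (hv : 0 ≤ v) :
    0 < powQuantile p a b v :=
  Real.rpow_pos_of_pos (powQuantile_base_pos hp ha hab hv) _

theorem powQuantile_zero (hp : p ≠ 0) (ha : 0 ≤ a) : powQuantile p a b 0 = a := by
  rw [powQuantile, zero_mul, add_zero, ← Real.rpow_mul ha, mul_one_div_cancel hp, Real.rpow_one]

theorem powQuantile_one (hp : p ≠ 0) (hb : 0 ≤ b) : powQuantile p a b 1 = b := by
  rw [powQuantile, one_mul, add_sub_cancel, ← Real.rpow_mul hb, mul_one_div_cancel hp,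
    Real.rpow_one]

theorem hasDerivAt_powQuantile (hp : 0 < p) (ha : 0 < a) (hab : a < b) (hv : 0 ≤ v) :
    HasDerivAt (powQuantile p a b)
      ((b ^ p - a ^ p) / p * powQuantile p a b v ^ (1 - p)) v := by
  have hbase := powQuantile_base_pos hp ha hab hv
  have h := ((((hasDerivAt_id v).mul_const (b ^ p - a ^ p)).const_add (a ^ p)).rpow_const
    (p := 1 / p) (Or.inl hbase.ne'))
  refine h.congr_deriv ?_
  rw [powQuantile, ← Real.rpow_mul hbase.le,
    show 1 / p * (1 - p) = 1 / p - 1 by field_simp]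
  simp only [id]
  ring

theorem powQuantile_lt_powQuantile {a' b' : ℝ} (hp : 0 < p) (ha : 0 < a) (hab : a < b)
    (haa' : a < a') (hbb' : b < b') (hv : v ∈ Icc (0 : ℝ) 1) :
    powQuantile p a b v < powQuantile p a' b' v := by
  refine Real.rpow_lt_rpow (powQuantile_base_pos hp ha hab hv.1).le ?_ (by positivity)
  have h1 := Real.rpow_lt_rpow ha.le haa' hp
  have h2 := Real.rpow_lt_rpow (ha.trans hab).le hbb' hp
  rcases hv.1.eq_or_lt with rfl | hv0
  · linarith
  · nlinarith [mul_pos hv0 (sub_pos.2 h2), mul_nonneg (sub_nonneg.2 hv.2) (sub_pos.2 h1).le]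

theorem continuousOn_powQuantile (hp : 0 < p) (ha : 0 < a) (hab : a < b) :
    ContinuousOn (powQuantile p a b) (Icc 0 1) := fun _ hv =>
  (hasDerivAt_powQuantile hp ha hab hv.1).continuousAt.continuousWithinAt

theorem integral_rpow_mul_eq_integral_powQuantile {φ : ℝ → ℝ} (hp : 0 < p) (ha : 0 < a)
    (hab : a < b) (hφ : ContinuousOn φ (Ioi 0)) :
    ∫ x in a..b, x ^ (p - 1) * φ x
      = (b ^ p - a ^ p) / p * ∫ v in (0 : ℝ)..1, φ (powQuantile p a b v) := by
  have hQ := continuousOn_powQuantile hp ha hab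
  have hu : uIcc (0 : ℝ) 1 = Icc 0 1 := uIcc_of_le zero_le_one
  have hQpos : ∀ v ∈ Icc (0 : ℝ) 1, 0 < powQuantile p a b v := fun v hv =>
    powQuantile_pos hp ha hab hv.1
  have h := intervalIntegral.integral_comp_mul_deriv' (a := 0) (b := 1)
    (f := powQuantile p a b)
    (f' := fun v => (b ^ p - a ^ p) / p * powQuantile p a b v ^ (1 - p))
    (g := fun x => x ^ (p - 1) * φ x)
    (fun v hv => hasDerivAt_powQuantile hp ha hab (hu ▸ hv).1)
    (by
      rw [hu]
      exact continuousOn_const.mul (hQ.rpow_const fun v hv => Or.inl (hQpos v hv).ne'))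
    (by
      rw [hu]
      have hpos : powQuantile p a b '' Icc 0 1 ⊆ Ioi 0 := by
        rintro _ ⟨v, hv, rfl⟩
        exact hQpos v hv
      exact ((continuousOn_id.rpow_const fun x hx => Or.inl (ne_of_gt hx)).mul hφ).mono hpos)
  rw [powQuantile_zero hp.ne' ha.le, powQuantile_one hp.ne' (ha.trans hab).le] at h
  rw [← h, ← intervalIntegral.integral_const_mul]
  refine intervalIntegral.integral_congr fun v hv => ?_
  have hv' := hQpos v (hu ▸ hv)
  have hcancel : powQuantile p a b v ^ (p - 1) * powQuantile p a b v ^ (1 - p) = 1 := by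
    rw [← Real.rpow_add hv']
    simp
  simp only [Function.comp_apply]
  linear_combination ((b ^ p - a ^ p) / p * φ (powQuantile p a b v)) * hcancel

end powQuantile

open Set in
theorem strictAntiOn_rpow_add_sub_rpow {p T : ℝ} (hp0 : 0 < p) (hp1 : p < 1) (hT : 0 < T) :
    StrictAntiOn (fun s : ℝ => (s + T) ^ p - s ^ p) (Ioi 0) := by
  have hd : ∀ s ∈ Ioi (0 : ℝ), HasDerivAt (fun s : ℝ => (s + T) ^ p - s ^ p)
      (p * ((s + T) ^ (p - 1) - s ^ (p - 1))) s := by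
    intro s hs
    have hs' : (0 : ℝ) < s := hs
    refine ((((hasDerivAt_id s).add_const T).rpow_const (p := p)
      (Or.inl (add_pos hs' hT).ne')).sub
      ((hasDerivAt_id s).rpow_const (p := p) (Or.inl hs'.ne'))).congr_deriv ?_
    simp only [id]
    ring
  refine strictAntiOn_of_deriv_neg (convex_Ioi 0)
    (fun s hs => (hd s hs).continuousAt.continuousWithinAt) fun s hs => ?_
  rw [interior_Ioi] at hs
  rw [(hd s hs).deriv]
  have hs' : (0 : ℝ) < s := hs
  have := Real.rpow_lt_rpow_of_neg hs' (show s < s + T by linarith) (by linarith : p - 1 < 0)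
  exact mul_neg_of_pos_of_neg hp0 (by linarith)

section logGap

open Set

variable {p ε a b v : ℝ}

theorem hasDerivAt_log_add_sub_log_powQuantile (hp : 0 < p) (hε : 0 < ε) (ha : 0 < a)
    (hab : a < b) (hv : 0 ≤ v) :
    HasDerivAt (fun v => Real.log (powQuantile p a b v + ε) - Real.log (powQuantile p a b v))
      (-(ε / p * ((b ^ p - a ^ p)
        * (powQuantile p a b v ^ (-p) / (powQuantile p a b v + ε))))) v := by
  have hQ := hasDerivAt_powQuantile hp ha hab hv
  have hpos := powQuantile_pos hp ha hab hv
  refine (((hQ.add_const ε).log (by positivity)).sub (hQ.log hpos.ne')).congr_deriv ?_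
  rw [show 1 - p = -p + 1 by ring, Real.rpow_add_one hpos.ne']
  field_simp
  ring

theorem strictAntiOn_log_add_sub_log_powQuantile (hp : 0 < p) (hε : 0 < ε) (ha : 0 < a)
    (hab : a < b) :
    StrictAntiOn (fun v => Real.log (powQuantile p a b v + ε) - Real.log (powQuantile p a b v))
      (Icc 0 1) := by
  have hd := fun v (hv : v ∈ Icc (0 : ℝ) 1) =>
    hasDerivAt_log_add_sub_log_powQuantile hp hε ha hab hv.1
  refine strictAntiOn_of_deriv_neg (convex_Icc 0 1)
    (fun v hv => (hd v hv).continuousAt.continuousWithinAt) fun v hv => ?_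
  have hv' := interior_subset hv
  rw [(hd v hv').deriv, neg_lt_zero]
  have hpos := powQuantile_pos hp ha hab hv'.1
  have hc := sub_pos.2 (Real.rpow_lt_rpow ha.le hab hp)
  positivity

theorem strictMonoOn_log_add_sub_log_powQuantile_sub {a' b' : ℝ} (hp : 0 < p) (hε : 0 < ε)
    (ha : 0 < a) (hab : a < b) (ha'b' : a' < b') (haa' : a < a') (hbb' : b < b')
    (hinc : b' ^ p - a' ^ p ≤ b ^ p - a ^ p) :
    StrictMonoOn (fun v =>
      (Real.log (powQuantile p a' b' v + ε) - Real.log (powQuantile p a' b' v))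
        - (Real.log (powQuantile p a b v + ε) - Real.log (powQuantile p a b v))) (Icc 0 1) := by
  have hd := fun v (hv : v ∈ Icc (0 : ℝ) 1) =>
    (hasDerivAt_log_add_sub_log_powQuantile hp hε (ha.trans haa') ha'b' hv.1).fun_sub
      (hasDerivAt_log_add_sub_log_powQuantile hp hε ha hab hv.1)
  refine strictMonoOn_of_deriv_pos (convex_Icc 0 1)
    (fun v hv => (hd v hv).continuousAt.continuousWithinAt) fun v hv => ?_
  have hv' := interior_subset hv
  rw [(hd v hv').deriv]
  have hx := powQuantile_pos hp ha hab hv'.1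
  have hxy := powQuantile_lt_powQuantile hp ha hab haa' hbb' hv'
  have hc := sub_pos.2 (Real.rpow_lt_rpow ha.le hab hp)
  have hpow := Real.rpow_lt_rpow_of_neg hx hxy (neg_lt_zero.2 hp)
  have hquot : powQuantile p a' b' v ^ (-p) / (powQuantile p a' b' v + ε)
      < powQuantile p a b v ^ (-p) / (powQuantile p a b v + ε) :=
    div_lt_div₀ hpow (by linarith) (by positivity) (by positivity)
  have hnonneg : 0 ≤ powQuantile p a' b' v ^ (-p) / (powQuantile p a' b' v + ε) := by
    have hy := hx.trans hxy
    positivity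
  have hmul := mul_lt_mul_of_pos_left
    (mul_lt_mul' hinc hquot hnonneg hc) (div_pos hε hp)
  linarith

end logGap

open Set in
/-- The correlation of `x ^ (H - 1/2)` and `(x + ε) ^ (H - 1/2)` in `L²[t - T, t]` as a ratio of
mean to root mean square in the quantile variable. -/
theorem integral_div_sqrt_eq_powQuantile {H T ε t : ℝ} (hH : 0 < H) (hT : 0 < T) (hε : 0 < ε)
    (ht : T < t) :
    (∫ u in (0:ℝ)..T, (t - u) ^ (H - 1/2) * (t + ε - u) ^ (H - 1/2)) /
        Real.sqrt ((∫ u in (0:ℝ)..T, (t - u) ^ (2*H - 1)) *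
          (∫ u in (0:ℝ)..T, (t + ε - u) ^ (2*H - 1)))
      = (∫ v in (0:ℝ)..1, Real.exp ((H - 1/2) * (Real.log (powQuantile (2*H) (t - T) t v + ε)
            - Real.log (powQuantile (2*H) (t - T) t v))))
        / √(∫ v in (0:ℝ)..1, Real.exp ((H - 1/2) * (Real.log (powQuantile (2*H) (t - T) t v + ε)
            - Real.log (powQuantile (2*H) (t - T) t v))) ^ 2) := by
  have hp : 0 < 2 * H := by linarith
  have ha : 0 < t - T := by linarith
  have hab : t - T < t := by linarith
  set r : ℝ → ℝ := fun x => Real.exp ((H - 1/2) * (Real.log (x + ε) - Real.log x)) with hr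
  have hrc : ContinuousOn r (Ioi 0) := by
    have h1 : ∀ x ∈ Ioi (0 : ℝ), x + ε ≠ 0 := fun x hx => (add_pos hx hε).ne'
    have h2 : ∀ x ∈ Ioi (0 : ℝ), x ≠ 0 := fun x hx => ne_of_gt hx
    fun_prop (disch := assumption)
  have hpos : ∀ x ∈ uIcc (t - T) t, 0 < x := fun x hx => by
    rw [uIcc_of_le hab.le] at hx
    exact ha.trans_le hx.1
  have hshift (h : ℝ → ℝ) : ∫ u in (0:ℝ)..T, h (t - u) = ∫ x in (t - T)..t, h x := by
    rw [intervalIntegral.integral_comp_sub_left, sub_zero]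
  have h1 : ∫ u in (0:ℝ)..T, (t - u) ^ (H - 1/2) * (t + ε - u) ^ (H - 1/2)
      = ∫ x in (t - T)..t, x ^ (2*H - 1) * r x := by
    simp only [add_sub_right_comm t ε]
    rw [hshift fun x => x ^ (H - 1/2) * (x + ε) ^ (H - 1/2)]
    refine intervalIntegral.integral_congr fun x hx => ?_
    have hx' := hpos x hx
    simp only [hr, Real.rpow_def_of_pos hx', Real.rpow_def_of_pos (add_pos hx' hε),
      ← Real.exp_add]
    ring_nf
  have h2 : ∫ u in (0:ℝ)..T, (t - u) ^ (2*H - 1)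
      = ∫ x in (t - T)..t, x ^ (2*H - 1) * (fun _ => (1 : ℝ)) x := by
    simpa only [mul_one] using hshift fun x => x ^ (2*H - 1)
  have h3 : ∫ u in (0:ℝ)..T, (t + ε - u) ^ (2*H - 1)
      = ∫ x in (t - T)..t, x ^ (2*H - 1) * (fun y => r y ^ 2) x := by
    simp only [add_sub_right_comm t ε]
    rw [hshift fun x => (x + ε) ^ (2*H - 1)]
    refine intervalIntegral.integral_congr fun x hx => ?_
    have hx' := hpos x hx
    simp only [hr, Real.rpow_def_of_pos hx', Real.rpow_def_of_pos (add_pos hx' hε),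
      ← Real.exp_nat_mul, ← Real.exp_add]
    push_cast
    ring_nf
  rw [h1, h2, h3, integral_rpow_mul_eq_integral_powQuantile hp ha hab hrc,
    integral_rpow_mul_eq_integral_powQuantile hp ha hab continuousOn_const,
    integral_rpow_mul_eq_integral_powQuantile hp ha hab (hrc.fun_pow 2)]
  have hk : 0 < (t ^ (2*H) - (t - T) ^ (2*H)) / (2*H) :=
    div_pos (sub_pos.2 (Real.rpow_lt_rpow ha.le hab hp)) hp
  generalize (t ^ (2*H) - (t - T) ^ (2*H)) / (2*H) = k at hk
  rw [intervalIntegral.integral_const, sub_zero, one_smul, mul_one, ← mul_assoc, ← sq,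
    Real.sqrt_mul (sq_nonneg k), Real.sqrt_sq hk.le, mul_div_mul_left _ _ hk.ne']

/-- The lag-`ε` correlation of the rough Bergomi Volterra process `V_t^T` is strictly
increasing in `t`: for `T < t₁ < t₂`, `corr(V_{t₁}^T, V_{t₁+ε}^T) < corr(V_{t₂}^T, V_{t₂+ε}^T)`,
where by the Itô isometry the correlation is expressed through the integrals below. -/
theorem stmt7 (H T ε : ℝ) (hH : H ∈ Set.Ioo (0:ℝ) (1/2)) (hT : 0 < T) (hε : 0 < ε)
    (t₁ t₂ : ℝ) (ht₁ : T < t₁) (ht₁₂ : t₁ < t₂) :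
    (∫ u in (0:ℝ)..T, (t₁ - u) ^ (H - 1/2) * (t₁ + ε - u) ^ (H - 1/2)) /
        Real.sqrt ((∫ u in (0:ℝ)..T, (t₁ - u) ^ (2*H - 1)) *
          (∫ u in (0:ℝ)..T, (t₁ + ε - u) ^ (2*H - 1)))
      < (∫ u in (0:ℝ)..T, (t₂ - u) ^ (H - 1/2) * (t₂ + ε - u) ^ (H - 1/2)) /
          Real.sqrt ((∫ u in (0:ℝ)..T, (t₂ - u) ^ (2*H - 1)) *
            (∫ u in (0:ℝ)..T, (t₂ + ε - u) ^ (2*H - 1))) := by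
  obtain ⟨hH0, hH1⟩ := hH
  have hp : 0 < 2 * H := by linarith
  have hk : H - 1/2 < 0 := by linarith
  have ha₁ : 0 < t₁ - T := by linarith
  have ha₂ : 0 < t₂ - T := by linarith
  have hab₁ : t₁ - T < t₁ := by linarith
  have hab₂ : t₂ - T < t₂ := by linarith
  rw [integral_div_sqrt_eq_powQuantile hH0 hT hε ht₁,
    integral_div_sqrt_eq_powQuantile hH0 hT hε (ht₁.trans ht₁₂)]
  have hcont {t : ℝ} (ha : 0 < t - T) (hab : t - T < t) : ContinuousOn (fun v =>
      Real.exp ((H - 1/2) * (Real.log (powQuantile (2*H) (t - T) t v + ε)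
        - Real.log (powQuantile (2*H) (t - T) t v)))) (Set.Icc 0 1) := fun v hv =>
    ((hasDerivAt_log_add_sub_log_powQuantile hp hε ha hab hv.1).const_mul
      (H - 1/2)).exp.continuousAt.continuousWithinAt
  have hmono {t : ℝ} (ha : 0 < t - T) (hab : t - T < t) : StrictMonoOn (fun v =>
      Real.exp ((H - 1/2) * (Real.log (powQuantile (2*H) (t - T) t v + ε)
        - Real.log (powQuantile (2*H) (t - T) t v)))) (Set.Icc 0 1) := fun u hu v hv huv =>
    Real.exp_lt_exp.2 (mul_lt_mul_of_neg_left
      (strictAntiOn_log_add_sub_log_powQuantile hp hε ha hab hu hv huv) hk)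
  refine integral_div_sqrt_lt_of_strictAntiOn_div zero_lt_one (hcont ha₁ hab₁) (hcont ha₂ hab₂)
    (hmono ha₁ hab₁) (hmono ha₂ hab₂) (fun _ _ => Real.exp_pos _) (fun _ _ => Real.exp_pos _)
    fun u hu v hv huv => ?_
  have hinc : t₂ ^ (2*H) - (t₂ - T) ^ (2*H) ≤ t₁ ^ (2*H) - (t₁ - T) ^ (2*H) := by
    simpa using (strictAntiOn_rpow_add_sub_rpow hp (by linarith) hT ha₁ ha₂
      (sub_lt_sub_right ht₁₂ T)).le
  have hgap := strictMonoOn_log_add_sub_log_powQuantile_sub hp hε ha₁ hab₁ hab₂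
    (sub_lt_sub_right ht₁₂ T) ht₁₂ hinc hu hv huv
  simp only [← Real.exp_sub, ← mul_sub]
  exact Real.exp_lt_exp.2 (mul_lt_mul_of_neg_left hgap hk)
end

section
/- In the VIX framework below, assume additionally that T > 0 and that for all u,t ∈ [T,T+Δ] the law of G(·,u) + G(·,t) is the Gaussian measure with mean 0 and variance v(u) + v(t) + 2c(u,t), where v(s) := (s^{2H} − (s−T)^{2H})/(2H) and c(u,t) := ∫_0^T ((u−r)·(t−r))^{H−1/2} dr. Define ΔVIX²_T(ω) := ∫_T^{T+Δ} ξ_T(ω,t) dt. Then E[(ΔVIX²_T)²] = ∫_T^{T+Δ} ∫_T^{T+Δ} ξ0(u)·ξ0(t) · exp( (ν²C_H²/H)·((u−T)^{2H} + (t−T)^{2H} − u^{2H} − t^{2H}) ) · exp( 2ν²C_H²·( v(u) + v(t) + 2c(u,t) ) ) du dt. -/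
open MeasureTheory ProbabilityTheory

/-- Variance `v(s) = (s^{2H} - (s-T)^{2H})/(2H)` of the Volterra increment. -/
noncomputable def vVar (H T s : ℝ) : ℝ := (s ^ (2*H) - (s - T) ^ (2*H)) / (2*H)

/-- Covariance `c(u,t) = ∫₀ᵀ ((u-r)(t-r))^{H-1/2} dr` of the Volterra process. -/
noncomputable def cCov (H T u t : ℝ) : ℝ := ∫ r in (0:ℝ)..T, ((u - r) * (t - r)) ^ (H - 1/2)

/-- The exponential moment of a centred real Gaussian variable. -/
lemma integral_exp_mul_of_map_eq_gaussianReal {Ω : Type*} [MeasurableSpace Ω] {P : Measure Ω}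
    {Y : Ω → ℝ} {w : ℝ} (hw : 0 ≤ w) (hY : P.map Y = gaussianReal 0 w.toNNReal) (a : ℝ) :
    ∫ ω, Real.exp (a * Y ω) ∂P = Real.exp (a ^ 2 * w / 2) := by
  have h := mgf_gaussianReal hY a
  rw [mgf, Real.coe_toNNReal w hw] at h
  rw [h]
  congr 1
  ring

/-- Fubini's theorem for the second moment of the time integral of a square-integrable process. -/
lemma integral_sq_integral {Ω α : Type*} [MeasurableSpace Ω] [MeasurableSpace α]
    {P : Measure Ω} [SFinite P] {μ : Measure α} [IsFiniteMeasure μ] {X : Ω → α → ℝ}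
    (hX : MemLp (Function.uncurry X) 2 (P.prod μ)) :
    ∫ ω, (∫ t, X ω t ∂μ) ^ 2 ∂P = ∫ u, ∫ t, ∫ ω, X ω u * X ω t ∂P ∂μ ∂μ := by
  have h1 : MemLp (fun p : Ω × α × α => X p.1 p.2.1) 2 (P.prod (μ.prod μ)) :=
    (hX.comp_fst μ).comp_measurePreserving (measurePreserving_prodAssoc P μ μ).symm
  have h2 : MemLp (fun p : Ω × α × α => X p.1 p.2.2) 2 (P.prod (μ.prod μ)) :=
    h1.comp_measurePreserving
      ((MeasurePreserving.id P).prod (Measure.measurePreserving_swap (μ := μ) (ν := μ)))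
  have hint : Integrable (Function.uncurry fun ω (z : α × α) => X ω z.1 * X ω z.2)
      (P.prod (μ.prod μ)) := h1.integrable_mul h2
  calc ∫ ω, (∫ t, X ω t ∂μ) ^ 2 ∂P
      = ∫ ω, ∫ z, X ω z.1 * X ω z.2 ∂(μ.prod μ) ∂P := by
        refine integral_congr_ae (.of_forall fun ω => ?_)
        simp only
        rw [integral_prod_mul (X ω) (X ω), sq]
    _ = ∫ z, ∫ ω, X ω z.1 * X ω z.2 ∂P ∂(μ.prod μ) := integral_integral_swap hint
    _ = ∫ u, ∫ t, ∫ ω, X ω u * X ω t ∂P ∂μ ∂μ := integral_prod _ hint.integral_prod_right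

lemma vVar_nonneg {H T s : ℝ} (hH : 0 < H) (hT : 0 ≤ T) (hs : T ≤ s) : 0 ≤ vVar H T s := by
  refine div_nonneg (sub_nonneg.2 ?_) (by positivity)
  exact Real.rpow_le_rpow (by linarith) (by linarith) (by positivity)

lemma cCov_nonneg {H T u t : ℝ} (hT : 0 ≤ T) (hu : T ≤ u) (ht : T ≤ t) : 0 ≤ cCov H T u t := by
  refine intervalIntegral.integral_nonneg hT fun r hr => Real.rpow_nonneg ?_ _
  exact mul_nonneg (by linarith [hr.2]) (by linarith [hr.2])

lemma continuous_vVar {H : ℝ} (hH : 0 < H) (T : ℝ) : Continuous (vVar H T) := by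
  have h : 0 ≤ 2 * H := by positivity
  exact ((continuous_id.rpow_const fun _ => .inr h).sub
    ((continuous_id.sub continuous_const).rpow_const fun _ => .inr h)).div_const _

/-- A process `f t * exp (a * Y t)`, with `f` continuous and `Y t` centred Gaussian of continuous
variance, is square-integrable on compact time intervals. -/
lemma memLp_two_mul_exp_gaussian {Ω : Type*} [MeasurableSpace Ω] {P : Measure Ω} [SFinite P]
    {b c a : ℝ} {f w : ℝ → ℝ} {Y : Ω → ℝ → ℝ} (hf : ContinuousOn f (Set.Icc b c))
    (hw : ContinuousOn w (Set.Icc b c)) (hw0 : ∀ t ∈ Set.Icc b c, 0 ≤ w t)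
    (hY : Measurable (Function.uncurry Y))
    (hlaw : ∀ t ∈ Set.Icc b c, P.map (fun ω => Y ω t) = gaussianReal 0 (w t).toNNReal) :
    MemLp (Function.uncurry fun ω t => f t * Real.exp (a * Y ω t)) 2
      (P.prod (volume.restrict (Set.Ioc b c))) := by
  have hmeas : AEStronglyMeasurable (Function.uncurry fun ω t => f t * Real.exp (a * Y ω t))
      (P.prod (volume.restrict (Set.Ioc b c))) := by
    have hf' : AEStronglyMeasurable f (volume.restrict (Set.Ioc b c)) :=
      (hf.mono Set.Ioc_subset_Icc_self).aestronglyMeasurable measurableSet_Ioc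
    exact hf'.comp_snd.mul
      (Real.measurable_exp.comp (hY.const_mul a)).aestronglyMeasurable
  have hsq : ∀ ω t, (f t * Real.exp (a * Y ω t)) ^ 2 = f t ^ 2 * Real.exp (2 * a * Y ω t) := by
    intro ω t
    rw [mul_pow, ← Real.exp_nat_mul]
    push_cast
    ring_nf
  have hmoment : ∀ t ∈ Set.Icc b c,
      ∫ ω, Real.exp (2 * a * Y ω t) ∂P = Real.exp ((2 * a) ^ 2 * w t / 2) := fun t ht =>
    integral_exp_mul_of_map_eq_gaussianReal (hw0 t ht) (hlaw t ht) (2 * a)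
  rw [memLp_two_iff_integrable_sq hmeas]
  refine (integrable_prod_iff' (hmeas.pow 2)).2 ?_
  simp only [Pi.pow_apply, Function.uncurry_apply_pair, hsq]
  constructor
  · refine (ae_restrict_iff' measurableSet_Ioc).2 (.of_forall fun t ht => ?_)
    refine Integrable.const_mul (Integrable.of_integral_ne_zero ?_) _
    rw [hmoment t (Set.Ioc_subset_Icc_self ht)]
    exact (Real.exp_pos _).ne'
  · have hcont : ContinuousOn (fun t => f t ^ 2 * Real.exp ((2 * a) ^ 2 * w t / 2))
        (Set.Icc b c) := by fun_prop
    refine (hcont.integrableOn_Icc.mono_set Set.Ioc_subset_Icc_self).congr_fun (fun t ht => ?_)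
      measurableSet_Ioc
    have hnorm : ∀ ω, ‖f t ^ 2 * Real.exp (2 * a * Y ω t)‖ = f t ^ 2 * Real.exp (2 * a * Y ω t) :=
      fun ω => Real.norm_of_nonneg (by positivity)
    simp only [hnorm]
    rw [integral_const_mul, hmoment t (Set.Ioc_subset_Icc_self ht)]

/-- Second moment of `ΔVIX²_T = ∫_T^{T+Δ} ξ_T(·,t) dt` in the rough Bergomi model. -/
theorem stmt9 {Ω : Type*} [MeasurableSpace Ω] (P : Measure Ω) [IsProbabilityMeasure P]
    (H ν T Δ : ℝ) (hH : H ∈ Set.Ioo (0:ℝ) (1/2)) (hν : 0 < ν) (hT : 0 < T) (hΔ : 0 < Δ)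
    (ξ0 : ℝ → ℝ) (hξ0cont : ContinuousOn ξ0 (Set.Icc T (T + Δ)))
    (hξ0pos : ∀ t ∈ Set.Icc T (T + Δ), 0 < ξ0 t)
    (G : Ω → ℝ → ℝ) (hGmeas : Measurable (Function.uncurry G))
    (hGlaw : ∀ t ∈ Set.Icc T (T + Δ), Measure.map (fun ω => G ω t) P =
      gaussianReal 0 (((t ^ (2*H) - (t - T) ^ (2*H)) / (2*H)).toNNReal))
    (hGsumlaw : ∀ u ∈ Set.Icc T (T + Δ), ∀ t ∈ Set.Icc T (T + Δ),
      Measure.map (fun ω => G ω u + G ω t) P =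
        gaussianReal 0 ((vVar H T u + vVar H T t + 2 * cCov H T u t).toNNReal)) :
    (∫ ω, (∫ t in T..(T + Δ),
        ξ0 t * Real.exp (2 * ν * C_H H * G ω t) *
          Real.exp ((ν^2 * (C_H H)^2 / H) * ((t - T)^(2*H) - t^(2*H))))^2 ∂P)
      = ∫ u in T..(T + Δ), ∫ t in T..(T + Δ), ξ0 u * ξ0 t *
          Real.exp ((ν^2 * (C_H H)^2 / H) *
            ((u - T)^(2*H) + (t - T)^(2*H) - u^(2*H) - t^(2*H))) *
          Real.exp (2 * ν^2 * (C_H H)^2 *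
            (vVar H T u + vVar H T t + 2 * cCov H T u t)) := by
  have hH0 : 0 < H := hH.1
  have hTΔ : T ≤ T + Δ := by linarith
  have hpow : 0 ≤ 2 * H := by positivity
  set f : ℝ → ℝ := fun t => ξ0 t *
    Real.exp ((ν^2 * (C_H H)^2 / H) * ((t - T)^(2*H) - t^(2*H))) with hf_def
  have hf : ContinuousOn f (Set.Icc T (T + Δ)) := by
    refine hξ0cont.mul (Continuous.continuousOn (Real.continuous_exp.comp
      (continuous_const.mul (Continuous.sub ?_ ?_))))
    · exact (continuous_id.sub continuous_const).rpow_const fun _ => .inr hpow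
    · exact continuous_id.rpow_const fun _ => .inr hpow
  have hL2 := memLp_two_mul_exp_gaussian (a := 2 * ν * C_H H) hf
    (continuous_vVar hH0 T).continuousOn (fun t ht => vVar_nonneg hH0 hT.le ht.1) hGmeas hGlaw
  have hξ : ∀ ω t, ξ0 t * Real.exp (2 * ν * C_H H * G ω t) *
      Real.exp ((ν^2 * (C_H H)^2 / H) * ((t - T)^(2*H) - t^(2*H))) =
      f t * Real.exp (2 * ν * C_H H * G ω t) := fun ω t => by
    rw [hf_def]
    ring
  simp only [hξ, intervalIntegral.integral_of_le hTΔ]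
  rw [integral_sq_integral hL2]
  refine setIntegral_congr_fun measurableSet_Ioc fun u hu =>
    setIntegral_congr_fun measurableSet_Ioc fun t ht => ?_
  have hu' := Set.Ioc_subset_Icc_self hu
  have ht' := Set.Ioc_subset_Icc_self ht
  have hprod : ∀ ω, f u * Real.exp (2 * ν * C_H H * G ω u) *
      (f t * Real.exp (2 * ν * C_H H * G ω t)) =
      f u * f t * Real.exp (2 * ν * C_H H * (G ω u + G ω t)) := fun ω => by
    rw [mul_add, Real.exp_add]
    ring
  have hw : 0 ≤ vVar H T u + vVar H T t + 2 * cCov H T u t := by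
    linarith [vVar_nonneg hH0 hT.le hu'.1, vVar_nonneg hH0 hT.le ht'.1,
      cCov_nonneg (H := H) hT.le hu'.1 ht'.1]
  simp only [hprod]
  rw [integral_const_mul, integral_exp_mul_of_map_eq_gaussianReal hw (hGsumlaw u hu' t ht')]
  have hexp : Real.exp ((ν^2 * (C_H H)^2 / H) *
      ((u - T)^(2*H) + (t - T)^(2*H) - u^(2*H) - t^(2*H))) =
      Real.exp ((ν^2 * (C_H H)^2 / H) * ((u - T)^(2*H) - u^(2*H))) *
        Real.exp ((ν^2 * (C_H H)^2 / H) * ((t - T)^(2*H) - t^(2*H))) := by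
    rw [← Real.exp_add]
    ring_nf
  rw [hexp, show (2 * ν * C_H H) ^ 2 * (vVar H T u + vVar H T t + 2 * cCov H T u t) / 2 =
    2 * ν^2 * (C_H H)^2 * (vVar H T u + vVar H T t + 2 * cCov H T u t) by ring]
  simp only [hf_def]
  ring
end

section
/- Let Δ > 0, I > 0, σ > 0, K > 0, set μ := log I − σ²/2, K̃ := ( log(K²·Δ) − log I + σ²/2 )/σ, d₁ := −K̃ + σ/2 and d₂ := −K̃. Then ∫_ℝ max( Δ^{−1/2}·exp(x/2) − K, 0 ) dγ(x) = Δ^{−1/2}·sqrt(I)·exp(−σ²/8)·Φ(d₁) − K·Φ(d₂), where γ is the Gaussian measure on ℝ with mean μ and variance σ², and Φ is the standard normal CDF Φ(x) = ∫_{−∞}^x (2π)^{−1/2}·e^{−z²/2} dz. -/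
open MeasureTheory ProbabilityTheory

/-- The standard normal cumulative distribution function
`Φ(x) = ∫_{-∞}^x (2π)^{-1/2} e^{-z²/2} dz`. -/
noncomputable def stdNormalCDF (x : ℝ) : ℝ :=
  ∫ z in Set.Iic x, (2 * Real.pi) ^ (-(1/2) : ℝ) * Real.exp (-z^2 / 2)

lemma gaussianPDFReal_zero_one (z : ℝ) :
    gaussianPDFReal 0 1 z = (2 * Real.pi) ^ (-(1/2) : ℝ) * Real.exp (-z^2 / 2) := by
  rw [gaussianPDFReal_def, Real.rpow_neg (by positivity), ← Real.sqrt_eq_rpow]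
  simp

lemma stdNormalCDF_eq_setIntegral_gaussianPDFReal (x : ℝ) :
    stdNormalCDF x = ∫ z in Set.Iic x, gaussianPDFReal 0 1 z := by
  simp only [stdNormalCDF, gaussianPDFReal_zero_one]

lemma exp_mul_gaussianPDFReal_zero_one (a z : ℝ) :
    Real.exp (-a * z) * gaussianPDFReal 0 1 z
      = Real.exp (a^2 / 2) * gaussianPDFReal 0 1 (z + a) := by
  rw [gaussianPDFReal_zero_one, gaussianPDFReal_zero_one, mul_left_comm, mul_left_comm (Real.exp _),
    ← Real.exp_add, ← Real.exp_add]
  ring_nf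

lemma setIntegral_Iic_exp_mul_gaussianPDFReal (a d : ℝ) :
    ∫ z in Set.Iic d, Real.exp (-a * z) * gaussianPDFReal 0 1 z
      = Real.exp (a^2 / 2) * stdNormalCDF (d + a) := by
  simp_rw [exp_mul_gaussianPDFReal_zero_one]
  rw [integral_const_mul, stdNormalCDF_eq_setIntegral_gaussianPDFReal,
    ← (measurePreserving_add_right volume a).setIntegral_preimage_emb
      (measurableEmbedding_addRight a) (gaussianPDFReal 0 1) (Set.Iic (d + a))]
  simp

lemma integrable_exp_mul_gaussianPDFReal (a : ℝ) :
    Integrable fun z ↦ Real.exp (-a * z) * gaussianPDFReal 0 1 z := by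
  simp_rw [exp_mul_gaussianPDFReal_zero_one]
  exact ((integrable_gaussianPDFReal 0 1).comp_add_right a).const_mul _

/-- Expected call payoff under the standard normal law, with `d` the exercise boundary. -/
lemma integral_max_exp_sub_gaussianReal {A K a d : ℝ}
    (hd : A * Real.exp (-a * d) = K) (hA : 0 ≤ A) (ha : 0 ≤ a) :
    ∫ z, max (A * Real.exp (-a * z) - K) 0 ∂(gaussianReal 0 1)
      = A * Real.exp (a^2 / 2) * stdNormalCDF (d + a) - K * stdNormalCDF d := by
  rw [integral_gaussianReal_eq_integral_smul one_ne_zero]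
  have key : (fun z ↦ gaussianPDFReal 0 1 z • max (A * Real.exp (-a * z) - K) 0)
      = (Set.Iic d).indicator fun z ↦
        A * (Real.exp (-a * z) * gaussianPDFReal 0 1 z) - K * gaussianPDFReal 0 1 z := by
    ext z
    by_cases hz : z ≤ d
    · have : A * Real.exp (-a * d) ≤ A * Real.exp (-a * z) := by
        gcongr A * Real.exp ?_
        nlinarith
      rw [Set.indicator_of_mem (Set.mem_Iic.2 hz), max_eq_left (by linarith), smul_eq_mul]
      ring
    · have : A * Real.exp (-a * z) ≤ A * Real.exp (-a * d) := by
        gcongr A * Real.exp ?_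
        nlinarith
      rw [Set.indicator_of_notMem (by simpa using hz), max_eq_right (by linarith), smul_zero]
  rw [key, integral_indicator measurableSet_Iic,
    integral_sub ((integrable_exp_mul_gaussianPDFReal a).const_mul A).integrableOn
      ((integrable_gaussianPDFReal 0 1).const_mul K).integrableOn,
    integral_const_mul, integral_const_mul, setIntegral_Iic_exp_mul_gaussianPDFReal,
    stdNormalCDF_eq_setIntegral_gaussianPDFReal d, mul_assoc A]

/-- Black–Scholes-type closed-form price of a European Call on a VIX future under the
log-normal assumption: `E[(VIX_T − K)₊] = Δ^{-1/2} sqrt(I) e^{−σ²/8} Φ(d₁) − K Φ(d₂)`. -/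
theorem stmt12 (Δ I σ K μ K' d₁ d₂ : ℝ) (hΔ : 0 < Δ) (hI : 0 < I) (hσ : 0 < σ) (hK : 0 < K)
    (hμ : μ = Real.log I - σ^2 / 2)
    (hK' : K' = (Real.log (K^2 * Δ) - Real.log I + σ^2 / 2) / σ)
    (hd₁ : d₁ = -K' + σ / 2) (hd₂ : d₂ = -K') :
    ∫ x, max (Δ ^ (-(1/2) : ℝ) * Real.exp (x / 2) - K) 0
        ∂(gaussianReal μ (σ^2).toNNReal)
      = Δ ^ (-(1/2) : ℝ) * Real.sqrt I * Real.exp (-σ^2 / 8) * stdNormalCDF d₁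
        - K * stdNormalCDF d₂ := by
  have hmap : gaussianReal μ (σ^2).toNNReal
      = (gaussianReal 0 1).map (fun z ↦ μ + (-σ) * z) := by
    have := gaussianReal_map_const_mul (μ := 0) (v := 1) (-σ)
    rw [show (fun z ↦ μ + (-σ) * z) = (fun x ↦ μ + x) ∘ (fun z ↦ (-σ) * z) from rfl,
      ← Measure.map_map (by fun_prop) (by fun_prop), this, gaussianReal_map_const_add]
    congr 1
    · simp
    · ext
      simp [sq_nonneg]
  have hσd : σ * d₂ = μ - Real.log (K^2 * Δ) := by
    rw [hd₂, hK', hμ]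
    field_simp
    ring
  have hboundary : Δ ^ (-(1/2) : ℝ) * Real.exp (μ / 2) * Real.exp (-(σ / 2) * d₂) = K := by
    rw [mul_assoc, ← Real.exp_add, Real.rpow_def_of_pos hΔ, ← Real.exp_add]
    rw [Real.log_mul (by positivity) hΔ.ne', Real.log_pow] at hσd
    push_cast at hσd
    conv_rhs => rw [← Real.exp_log hK]
    congr 1
    linarith
  have hsqrt : Real.exp (μ / 2) * Real.exp ((σ / 2)^2 / 2)
      = Real.sqrt I * Real.exp (-σ^2 / 8) := by
    rw [Real.sqrt_eq_rpow, Real.rpow_def_of_pos hI, ← Real.exp_add, ← Real.exp_add, hμ]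
    ring_nf
  rw [hmap, integral_map (by fun_prop) (by fun_prop)]
  have hpayoff (z : ℝ) : Δ ^ (-(1/2) : ℝ) * Real.exp ((μ + -σ * z) / 2)
      = Δ ^ (-(1/2) : ℝ) * Real.exp (μ / 2) * Real.exp (-(σ / 2) * z) := by
    rw [mul_assoc, ← Real.exp_add]
    ring_nf
  simp_rw [hpayoff]
  rw [integral_max_exp_sub_gaussianReal hboundary (by positivity) (by positivity),
    mul_assoc _ (Real.exp (μ / 2)), hsqrt, hd₁, ← hd₂, mul_assoc _ (Real.sqrt I)]
end
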